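/- Let n ≥ 1, 0 < t_1 < … < t_n < u with F(t_1) > 0, and let 𝔤 : (0,∞) × ℝ → ℝ be bounded measurable. Then ℙ-a.s., E[𝔤(τ, ξ_u) | σ(ξ_{t_1}, …, ξ_{t_n})] = ∫_{(0,t_1]} (𝔤(r,0)/F(t_1)) ℙ_τ(dr) · 1_{{ξ_{t_1} = 0}} + ∑_{k=1}^{n−1} ∫_{(t_k,t_{k+1}]} 𝔤(r,0) ψ_k(r, ξ_{t_k}) ℙ_τ(dr) · 1_{{ξ_{t_k} ≠ 0, ξ_{t_{k+1}} = 0}} + ∫_{(t_n,u]} 𝔤(r,0) ϕ_{ξ^r_{t_n}}(ξ_{t_n}) ℙ_τ(dr) · 1_{{ξ_{t_n} ≠ 0}} + ∫_{(u,∞)} (∫_ℝ 𝔤(r,y) p(B_{t_n,u} B_{u,r}/B_{t_n,r}, y, (B_{u,r}/B_{t_n,r}) ξ_{t_n}) dy) ϕ_{ξ^r_{t_n}}(ξ_{t_n}) ℙ_τ(dr) · 1_{{ξ_{t_n} ≠ 0}}. -/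

import Mathlib

open MeasureTheory ProbabilityTheory Real Set

/-- A continuous centered Gaussian process on the line whose covariance factorizes as
`ρ (min s t) * q (max s t)` at positive times, without degeneracy at distinct times. -/
structure IsGaussMarkov {Ω : Type*} [MeasurableSpace Ω] (P : Measure Ω) (X : ℝ → Ω → ℝ)
    (ρ q : ℝ → ℝ) : Prop where
  measurable : ∀ t, Measurable (X t)
  continuous : ∀ ω, Continuous fun t => X t ω
  gaussian : IsGaussianProcess X P
  mean : ∀ t, ∫ ω, X t ω ∂P = 0
  covariance : ∀ s t, 0 < s → s ≤ t → cov[X s, X t; P] = ρ s * q t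
  continuous_rho : Continuous ρ
  continuous_q : Continuous q
  rho_pos : ∀ t, 0 < t → 0 < ρ t
  q_pos : ∀ t, 0 < t → 0 < q t
  det_pos : ∀ s t, 0 < s → s < t → 0 < ρ t * q s - ρ s * q t

namespace IsGaussMarkov

/-- A linear combination of three values of a process. -/
def comb {Ω : Type*} (X : ℝ → Ω → ℝ) (a : Fin 3 → ℝ × ℝ) (ω : Ω) : ℝ :=
  ∑ i, (a i).1 * X (a i).2 ω

lemma comb_apply {Ω : Type*} (X : ℝ → Ω → ℝ) (a b c s t r : ℝ) (ω : Ω) :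
    comb X ![(a, s), (b, t), (c, r)] ω = a * X s ω + b * X t ω + c * X r ω := by
  simp [comb, Fin.sum_univ_three]

variable {Ω : Type*} [MeasurableSpace Ω] {P : Measure Ω} {X : ℝ → Ω → ℝ} {ρ q : ℝ → ℝ}

lemma isGaussianProcess_comb (h : IsGaussMarkov P X ρ q) : IsGaussianProcess (comb X) P := by
  classical
  refine IsGaussianProcess.of_isGaussianProcess h.gaussian fun a =>
    ⟨Finset.univ.image fun i => (a i).2,
      { toFun x := ∑ i, (a i).1 * x ⟨(a i).2, by simp⟩
        map_add' x y := by simp [mul_add, Finset.sum_add_distrib]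
        map_smul' m x := by
          simp only [Pi.smul_apply, smul_eq_mul, RingHom.id_apply, Finset.mul_sum]
          exact Finset.sum_congr rfl fun i _ => by ring
        cont := by fun_prop }, fun ω => ?_⟩
  simp [comb]

lemma measurable_comb (h : IsGaussMarkov P X ρ q) (a : Fin 3 → ℝ × ℝ) :
    Measurable (comb X a) :=
  Finset.measurable_fun_sum _ fun _ _ => (h.measurable _).const_mul _

lemma integral_comb (h : IsGaussMarkov P X ρ q) (a : Fin 3 → ℝ × ℝ) :
    ∫ ω, comb X a ω ∂P = 0 := by
  unfold comb
  rw [integral_finsetSum]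
  · simp [integral_const_mul, h.mean]
  · exact fun _ _ => ((h.gaussian.hasGaussianLaw_eval _).integrable).const_mul _

lemma covariance_comb (h : IsGaussMarkov P X ρ q) (a b : Fin 3 → ℝ × ℝ) :
    cov[comb X a, comb X b; P] =
      ∑ i, ∑ j, (a i).1 * ((b j).1 * cov[X (a i).2, X (b j).2; P]) := by
  have := h.gaussian.isProbabilityMeasure
  have hm : ∀ (a : Fin 3 → ℝ × ℝ) i, MemLp (fun ω => (a i).1 * X (a i).2 ω) 2 P := fun a i =>
    (h.gaussian.hasGaussianLaw_eval _).memLp_two.const_mul _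
  unfold comb
  rw [covariance_fun_sum_fun_sum (hm a) (hm b)]
  simp [covariance_const_mul_left, covariance_const_mul_right, mul_left_comm]

lemma covariance_swap (h : IsGaussMarkov P X ρ q) {s t : ℝ} (hs : 0 < s) (hst : s ≤ t) :
    cov[X t, X s; P] = ρ s * q t := by
  rw [covariance_comm, h.covariance s t hs hst]

/-- Jointly Gaussian families of linear combinations are independent when uncorrelated. -/
lemma indepFun_comb (h : IsGaussMarkov P X ρ q) {ι κ : Type*} (a : ι → Fin 3 → ℝ × ℝ)
    (b : κ → Fin 3 → ℝ × ℝ) (hab : ∀ i j, cov[comb X (a i), comb X (b j); P] = 0) :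
    IndepFun (fun ω i => comb X (a i) ω) (fun ω j => comb X (b j) ω) P := by
  refine IsGaussianProcess.indepFun_of_covariance_eq_zero ?_
    (fun s => (h.measurable_comb _).aemeasurable) (fun s => (h.measurable_comb _).aemeasurable) hab
  convert! h.isGaussianProcess_comb.comp_right (Sum.elim a b) using 1
  ext i ω
  cases i <;> rfl

lemma map_comb (h : IsGaussMarkov P X ρ q) (a : Fin 3 → ℝ × ℝ) :
    P.map (comb X a) = gaussianReal 0 (cov[comb X a, comb X a; P]).toNNReal := by
  rw [(h.isGaussianProcess_comb.hasGaussianLaw_eval a).map_eq_gaussianReal, h.integral_comb,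
    covariance_self (h.measurable_comb a).aemeasurable]

/-- Variance at time `s` of the bridge of length `r`. -/
noncomputable def bridgeVar (ρ q : ℝ → ℝ) (s r : ℝ) : ℝ := ρ s * (ρ r * q s - ρ s * q r) / ρ r

/-- Slope of the regression of the bridge of length `r` at time `u` on its value at time `s`. -/
noncomputable def slope (ρ q : ℝ → ℝ) (s u r : ℝ) : ℝ :=
  (ρ r * q u - ρ u * q r) / (ρ r * q s - ρ s * q r)

/-- Conditional variance of the bridge of length `r` at time `u` given its value at time `s`. -/
noncomputable def condVar (ρ q : ℝ → ℝ) (s u r : ℝ) : ℝ :=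
  (ρ u * q s - ρ s * q u) * (ρ r * q u - ρ u * q r) / (ρ r * q s - ρ s * q r)

lemma bridgeVar_pos (h : IsGaussMarkov P X ρ q) {s r : ℝ} (hs : 0 < s) (hsr : s < r) :
    0 < bridgeVar ρ q s r :=
  div_pos (mul_pos (h.rho_pos s hs) (h.det_pos s r hs hsr)) (h.rho_pos r (hs.trans hsr))

lemma condVar_pos (h : IsGaussMarkov P X ρ q) {s u r : ℝ} (hs : 0 < s) (hsu : s < u)
    (hur : u < r) : 0 < condVar ρ q s u r :=
  div_pos (mul_pos (h.det_pos s u hs hsu) (h.det_pos u r (hs.trans hsu) hur))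
    (h.det_pos s r hs (hsu.trans hur))

/-- The value at time `s` of the bridge of length `r > s`. -/
lemma map_bridge (h : IsGaussMarkov P X ρ q) {s r : ℝ} (hs : 0 < s) (hsr : s < r) :
    P.map (fun ω => X s ω - ρ s / ρ r * X r ω) =
      gaussianReal 0 (bridgeVar ρ q s r).toNNReal := by
  have h1 : (fun ω => X s ω - ρ s / ρ r * X r ω) =
      comb X ![(1, s), (-(ρ s / ρ r), r), (0, r)] := by
    ext ω; rw [comb_apply]; ring
  have hr := h.rho_pos r (hs.trans hsr)
  rw [h1, h.map_comb, h.covariance_comb]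
  congr 2
  simp [Fin.sum_univ_three, h.covariance s s hs le_rfl, h.covariance s r hs hsr.le,
    h.covariance_swap hs hsr.le, h.covariance r r (hs.trans hsr) le_rfl]
  unfold bridgeVar
  field_simp
  ring

lemma indepFun_bridge (h : IsGaussMarkov P X ρ q) {ι : Type*} (a : ι → ℝ) {s r : ℝ}
    (ha : ∀ i, 0 < a i ∧ a i ≤ s) (hs : 0 < s) (hsr : s < r) :
    IndepFun (fun ω i => X (a i) ω - ρ (a i) / ρ s * X s ω)
      (fun ω => X s ω - ρ s / ρ r * X r ω) P := by
  have h0 := h.rho_pos s hs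
  have hr := h.rho_pos r (hs.trans hsr)
  have key := h.indepFun_comb (fun i => ![(1, a i), (-(ρ (a i) / ρ s), s), (0, s)])
    (fun _ : Unit => ![(1, s), (-(ρ s / ρ r), r), (0, r)]) fun i _ => by
      rw [h.covariance_comb]
      simp [Fin.sum_univ_three, h.covariance s s hs le_rfl, h.covariance s r hs hsr.le,
        h.covariance (a i) s (ha i).1 (ha i).2,
        h.covariance (a i) r (ha i).1 ((ha i).2.trans hsr.le)]
      field_simp
      ring
  convert! key.comp measurable_id (measurable_pi_apply ()) using 1
  · ext ω i; simp [comb_apply]; ring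
  · ext ω; simp [comb_apply]; ring

lemma indepFun_bridge_residual (h : IsGaussMarkov P X ρ q) {ι : Type*} (a : ι → ℝ) {s u r : ℝ}
    (ha : ∀ i, 0 < a i ∧ a i ≤ s) (hs : 0 < s) (hsu : s < u) (hur : u < r) :
    IndepFun
      (fun ω => ((fun i => X (a i) ω - ρ (a i) / ρ s * X s ω), X s ω - ρ s / ρ r * X r ω))
      (fun ω => (X u ω - ρ u / ρ r * X r ω) -
        slope ρ q s u r * (X s ω - ρ s / ρ r * X r ω)) P := by
  have hu := hs.trans hsu
  have hsr := hsu.trans hur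
  have h0 := h.rho_pos s hs
  have hr := h.rho_pos r (hs.trans hsr)
  have hd := h.det_pos s r hs hsr
  have key := h.indepFun_comb
    (fun i : Option ι => i.elim ![(1, s), (-(ρ s / ρ r), r), (0, r)]
      fun i => ![(1, a i), (-(ρ (a i) / ρ s), s), (0, s)])
    (fun _ : Unit => ![(1, u), (-slope ρ q s u r, s),
      (slope ρ q s u r * (ρ s / ρ r) - ρ u / ρ r, r)]) fun i _ => by
      rw [h.covariance_comb]
      cases i with
      | none =>
        simp [Fin.sum_univ_three, h.covariance s s hs le_rfl, h.covariance s r hs hsr.le,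
          h.covariance s u hs hsu.le, h.covariance_swap hs hsr.le, h.covariance_swap hu hur.le,
          h.covariance r r (hs.trans hsr) le_rfl]
        unfold slope
        field_simp
        ring
      | some i =>
        simp [Fin.sum_univ_three, h.covariance s s hs le_rfl, h.covariance s r hs hsr.le,
          h.covariance s u hs hsu.le,
          h.covariance (a i) s (ha i).1 (ha i).2,
          h.covariance (a i) u (ha i).1 ((ha i).2.trans hsu.le),
          h.covariance (a i) r (ha i).1 ((ha i).2.trans hsr.le)]
        field_simp
        ring
  convert! key.comp (φ := fun x : Option ι → ℝ => ((fun i => x (some i)), x none))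
    (by fun_prop) (measurable_pi_apply ()) using 1
  · ext ω i
    · simp [comb_apply]; ring
    · simp [comb_apply]; ring
  · ext ω; simp [comb_apply]; ring

lemma map_residual (h : IsGaussMarkov P X ρ q) {s u r : ℝ} (hs : 0 < s) (hsu : s < u)
    (hur : u < r) :
    P.map (fun ω => (X u ω - ρ u / ρ r * X r ω) -
      slope ρ q s u r * (X s ω - ρ s / ρ r * X r ω)) =
      gaussianReal 0 (condVar ρ q s u r).toNNReal := by
  have hu := hs.trans hsu
  have hsr := hsu.trans hur
  have hr := h.rho_pos r (hs.trans hsr)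
  have hd := h.det_pos s r hs hsr
  have h1 : (fun ω => (X u ω - ρ u / ρ r * X r ω) -
      slope ρ q s u r * (X s ω - ρ s / ρ r * X r ω)) =
      comb X ![(1, u), (-slope ρ q s u r, s),
        (slope ρ q s u r * (ρ s / ρ r) - ρ u / ρ r, r)] := by
    ext ω; rw [comb_apply]; ring
  rw [h1, h.map_comb, h.covariance_comb]
  congr 2
  simp [Fin.sum_univ_three, h.covariance s s hs le_rfl, h.covariance s r hs hsr.le,
    h.covariance_swap hs hsr.le, h.covariance r r (hs.trans hsr) le_rfl,
    h.covariance u u hu le_rfl, h.covariance u r hu hur.le, h.covariance_swap hu hur.le,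
    h.covariance s u hs hsu.le, h.covariance_swap hs hsu.le]
  have hk : slope ρ q s u r * (ρ r * q s - ρ s * q r) = ρ r * q u - ρ u * q r :=
    div_mul_cancel₀ _ hd.ne'
  have hv : condVar ρ q s u r = slope ρ q s u r * (ρ u * q s - ρ s * q u) := by
    unfold condVar slope; ring
  rw [hv]
  generalize slope ρ q s u r = k at hk ⊢
  field_simp
  linear_combination (k * ρ s - ρ u) * hk

end IsGaussMarkov

section Posterior

variable {α E : Type*} [MeasurableSpace α]

/-- Posterior mean of `G` under the prior `ν` with likelihood `φ`, after observing `y`. -/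
noncomputable def posteriorMean (ν : Measure α) (φ G : α → E → ℝ) (y : E) : ℝ :=
  (∫ r, G r y * φ r y ∂ν) / ∫ r, φ r y ∂ν

lemma measurable_posteriorMean [MeasurableSpace E] {ν : Measure α} [SFinite ν] {φ G : α → E → ℝ}
    (hφ : Measurable (Function.uncurry φ)) (hG : Measurable (Function.uncurry G)) :
    Measurable (posteriorMean ν φ G) := by
  refine Measurable.div ?_ ?_
  · exact ((hG.mul hφ).comp measurable_swap).stronglyMeasurable.integral_prod_right'.measurable
  · exact (hφ.comp measurable_swap).stronglyMeasurable.integral_prod_right'.measurable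

lemma abs_posteriorMean_le {ν : Measure α} {φ G : α → E → ℝ} (hφ0 : ∀ r y, 0 ≤ φ r y) {C : ℝ}
    (hG : ∀ r y, |G r y| ≤ C) (hC : 0 ≤ C) (y : E) : |posteriorMean ν φ G y| ≤ C := by
  unfold posteriorMean
  by_cases hi : Integrable (fun r => φ r y) ν
  · have h0 : 0 ≤ ∫ r, φ r y ∂ν := integral_nonneg fun r => hφ0 r y
    rw [abs_div, abs_of_nonneg h0]
    refine div_le_of_le_mul₀ h0 hC ?_
    rw [← integral_const_mul, ← Real.norm_eq_abs]
    refine norm_integral_le_of_norm_le (hi.const_mul C) (.of_forall fun r => ?_)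
    rw [norm_mul, Real.norm_eq_abs, Real.norm_of_nonneg (hφ0 r y)]
    exact mul_le_mul_of_nonneg_right (hG r y) (hφ0 r y)
  · simp [integral_undef hi, hC]

lemma posteriorMean_mul_integral {ν : Measure α} {φ G : α → E → ℝ} (hφ0 : ∀ r y, 0 ≤ φ r y)
    {y : E}
    (hi : Integrable (fun r => φ r y) ν) :
    posteriorMean ν φ G y * ∫ r, φ r y ∂ν = ∫ r, G r y * φ r y ∂ν := by
  unfold posteriorMean
  by_cases h0 : ∫ r, φ r y ∂ν = 0
  · have h1 := (integral_eq_zero_iff_of_nonneg (fun r => hφ0 r y) hi).1 h0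
    rw [h0, mul_zero, eq_comm]
    exact integral_eq_zero_of_ae (h1.mono fun r hr => by simp_all)
  · exact div_mul_cancel₀ _ h0

/-- Bayes' formula: `G` may be replaced by its posterior mean. -/
lemma integral_mul_posteriorMean [MeasurableSpace E] {ν : Measure α} [SFinite ν]
    {κ : Measure E} [SFinite κ]
    {φ G : α → E → ℝ} (hφ0 : ∀ r y, 0 ≤ φ r y) (hφ : Measurable (Function.uncurry φ))
    (hφi : Integrable (Function.uncurry φ) (ν.prod κ))
    (hG : Measurable (Function.uncurry G)) {C : ℝ} (hC : 0 ≤ C) (hGC : ∀ r y, |G r y| ≤ C)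
    {K : E → ℝ} (hK : Measurable K) {C' : ℝ} (hKC : ∀ y, |K y| ≤ C') :
    ∫ r, ∫ y, φ r y * (K y * G r y) ∂κ ∂ν =
      ∫ r, ∫ y, φ r y * (K y * posteriorMean ν φ G y) ∂κ ∂ν := by
  have hinteg : ∀ G : α → E → ℝ, Measurable (Function.uncurry G) → (∀ r y, |G r y| ≤ C) →
      Integrable (Function.uncurry fun r y => φ r y * (K y * G r y)) (ν.prod κ) := by
    intro G hG hGC
    refine hφi.mul_bdd (c := C' * C) ((hK.comp measurable_snd).mul hG).aestronglyMeasurable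
      (.of_forall fun z => ?_)
    rw [norm_mul]
    exact mul_le_mul (hKC _) (hGC _ _) (norm_nonneg _) ((abs_nonneg _).trans (hKC z.2))
  have hp := measurable_posteriorMean (ν := ν) hφ hG
  rw [integral_integral_swap (hinteg G hG hGC), integral_integral_swap
    (hinteg (fun _ => posteriorMean ν φ G) (hp.comp measurable_snd)
      fun _ => abs_posteriorMean_le hφ0 hGC hC)]
  refine integral_congr_ae (hφi.prod_left_ae.mono fun y hy => ?_)
  calc ∫ r, φ r y * (K y * G r y) ∂ν
      = K y * ∫ r, G r y * φ r y ∂ν := by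
        rw [← integral_const_mul]; congr 1; ext r; ring
    _ = K y * (posteriorMean ν φ G y * ∫ r, φ r y ∂ν) := by rw [posteriorMean_mul_integral hφ0 hy]
    _ = ∫ r, φ r y * (K y * posteriorMean ν φ G y) ∂ν := by rw [integral_mul_const]; ring

end Posterior

namespace IsGaussMarkov

/-- The density at time `s` of the bridge of length `r`. -/
noncomputable def density (ρ q : ℝ → ℝ) (s r x : ℝ) : ℝ :=
  gaussianPDFReal 0 (bridgeVar ρ q s r).toNNReal x

/-- The bridge of length `r` at time `s`. -/
noncomputable def bridge {Ω : Type*} (X : ℝ → Ω → ℝ) (ρ : ℝ → ℝ) (s r : ℝ) (ω : Ω) : ℝ :=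
  X s ω - ρ s / ρ (max r s) * X (max r s) ω

lemma bridge_of_lt {Ω : Type*} {X : ℝ → Ω → ℝ} {ρ : ℝ → ℝ} {s r : ℝ} (hsr : s < r) (ω : Ω) :
    bridge X ρ s r ω = X s ω - ρ s / ρ r * X r ω := by
  simp [bridge, max_eq_left hsr.le]

lemma density_nonneg (ρ q : ℝ → ℝ) (s r x : ℝ) : 0 ≤ density ρ q s r x :=
  gaussianPDFReal_nonneg _ _ _

variable {Ω : Type*} [MeasurableSpace Ω] {P : Measure Ω} {X : ℝ → Ω → ℝ} {ρ q : ℝ → ℝ}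

lemma measurable_bridgeVar (h : IsGaussMarkov P X ρ q) (s : ℝ) :
    Measurable (bridgeVar ρ q s) := by
  have := h.continuous_rho.measurable
  have := h.continuous_q.measurable
  unfold bridgeVar
  fun_prop

lemma measurable_density (h : IsGaussMarkov P X ρ q) (s : ℝ) :
    Measurable (Function.uncurry (density ρ q s)) := by
  have := h.measurable_bridgeVar s
  exact measurable_uncurry_gaussianPDFReal.comp
    (measurable_const.prodMk
      ((this.comp measurable_fst).real_toNNReal.prodMk measurable_snd))

lemma measurable_bridge (h : IsGaussMarkov P X ρ q) (s : ℝ) :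
    Measurable (Function.uncurry (bridge X ρ s)) := by
  have h1 := h.continuous_rho.measurable
  have h2 := h.measurable s
  have h3 : Measurable fun z : ℝ × Ω => X (max z.1 s) z.2 :=
    (measurable_uncurry_of_continuous_of_measurable h.continuous h.measurable).comp
      ((measurable_fst.max measurable_const).prodMk measurable_snd)
  exact (h2.comp measurable_snd).sub
    ((measurable_const.div (h1.comp (measurable_fst.max measurable_const))).mul h3)

lemma bridge_of_le (h : IsGaussMarkov P X ρ q) {s r : ℝ} (hs : 0 < s) (hrs : r ≤ s) (ω : Ω) :
    bridge X ρ s r ω = 0 := by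
  simp [bridge, max_eq_right hrs, div_self (h.rho_pos s hs).ne']

lemma ae_bridge_eq_zero_iff (h : IsGaussMarkov P X ρ q) {s : ℝ} (hs : 0 < s) (r : ℝ) :
    ∀ᵐ ω ∂P, bridge X ρ s r ω = 0 ↔ r ≤ s := by
  by_cases hsr : s < r
  · have hv : (bridgeVar ρ q s r).toNNReal ≠ 0 := by simp [h.bridgeVar_pos hs hsr]
    have h1 := h.map_bridge hs hsr
    have := nullSingletonClass_gaussianReal (μ := 0) hv
    have h2 : ∀ᵐ x ∂(P.map (fun ω => X s ω - ρ s / ρ r * X r ω)), x ≠ 0 := by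
      rw [h1]; simp [ae_iff]
    refine (ae_of_ae_map ?_ h2).mono fun ω hω => ?_
    · exact ((h.measurable s).sub ((h.measurable r).const_mul _)).aemeasurable
    · simp [bridge_of_lt hsr, hω, hsr]
  · exact .of_forall fun ω => by simp [h.bridge_of_le hs (not_lt.1 hsr), not_lt.1 hsr]

/-- The law of the bridge on `[0, s]`, disintegrated with respect to its value at time `s`. -/
lemma integral_bridge (h : IsGaussMarkov P X ρ q) {ι : Type*} [Finite ι] (a : ι → ℝ)
    {s r : ℝ} (ha : ∀ i, 0 < a i ∧ a i ≤ s) (hs : 0 < s) (hsr : s < r) {K : (ι → ℝ) × ℝ → ℝ}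
    (hK : Measurable K) :
    ∫ ω, K ((fun i => X (a i) ω - ρ (a i) / ρ s * X s ω), bridge X ρ s r ω) ∂P =
      ∫ y, density ρ q s r y.2 * K y
        ∂(P.map fun ω i => X (a i) ω - ρ (a i) / ρ s * X s ω).prod volume := by
  have := h.gaussian.isProbabilityMeasure
  have hv : (bridgeVar ρ q s r).toNNReal ≠ 0 := by simp [h.bridgeVar_pos hs hsr]
  have hm1 : Measurable fun ω (i : ι) => X (a i) ω - ρ (a i) / ρ s * X s ω :=
    measurable_pi_lambda _ fun i => (h.measurable _).sub ((h.measurable _).const_mul _)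
  have hm2 : Measurable fun ω => X s ω - ρ s / ρ r * X r ω :=
    (h.measurable s).sub ((h.measurable r).const_mul _)
  have := Measure.isProbabilityMeasure_map (μ := P) hm1.aemeasurable
  simp only [bridge_of_lt hsr]
  rw [← integral_map (f := K) (hm1.prodMk hm2).aemeasurable hK.aestronglyMeasurable,
    (h.indepFun_bridge a ha hs hsr).map_prod_eq_prod_map_map hm1.aemeasurable hm2.aemeasurable,
    h.map_bridge hs hsr, gaussianReal_of_var_ne_zero _ hv,
    prod_withDensity_right (measurable_gaussianPDF _ _),
    integral_withDensity_eq_integral_toReal_smul (by fun_prop)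
      (.of_forall fun _ => gaussianPDF_lt_top)]
  simp [density]

/-- Prediction of the bridge of length `r` at time `u` from its past up to time `s`. -/
lemma integral_bridge_future (h : IsGaussMarkov P X ρ q) {ι : Type*} [Finite ι] (a : ι → ℝ)
    {s u r : ℝ} (ha : ∀ i, 0 < a i ∧ a i ≤ s) (hs : 0 < s) (hsu : s < u) (hur : u < r)
    {K : (ι → ℝ) × ℝ → ℝ} (hK : Measurable K) {C' : ℝ} (hKC : ∀ y, |K y| ≤ C')
    {g : ℝ → ℝ} (hg : Measurable g) {C : ℝ} (hgC : ∀ y, |g y| ≤ C) :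
    ∫ ω, K ((fun i => X (a i) ω - ρ (a i) / ρ s * X s ω), bridge X ρ s r ω) *
        g (bridge X ρ u r ω) ∂P =
      ∫ ω, K ((fun i => X (a i) ω - ρ (a i) / ρ s * X s ω), bridge X ρ s r ω) *
        (∫ y, g y * gaussianPDFReal (slope ρ q s u r * bridge X ρ s r ω)
          (condVar ρ q s u r).toNNReal y) ∂P := by
  have := h.gaussian.isProbabilityMeasure
  have hsr := hsu.trans hur
  have hv : (condVar ρ q s u r).toNNReal ≠ 0 := by simp [h.condVar_pos hs hsu hur]
  set k := slope ρ q s u r with hk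
  have hm0 : ∀ s, Measurable fun ω => X s ω - ρ s / ρ r * X r ω := fun s =>
    (h.measurable s).sub ((h.measurable r).const_mul _)
  have hm1 : Measurable fun ω => ((fun i => X (a i) ω - ρ (a i) / ρ s * X s ω),
      X s ω - ρ s / ρ r * X r ω) :=
    (measurable_pi_lambda _ fun i => (h.measurable _).sub ((h.measurable _).const_mul _)).prodMk
      (hm0 s)
  have hm2 : Measurable fun ω => (X u ω - ρ u / ρ r * X r ω) -
      k * (X s ω - ρ s / ρ r * X r ω) := (hm0 u).sub ((hm0 s).const_mul _)
  have hind := (h.indepFun_bridge_residual a ha hs hsu hur).map_prod_eq_prod_map_map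
    hm1.aemeasurable hm2.aemeasurable
  rw [h.map_residual hs hsu hur] at hind
  simp only [bridge_of_lt hsr, bridge_of_lt hur]
  have hF : Measurable fun z : ((ι → ℝ) × ℝ) × ℝ => K z.1 * g (z.2 + k * z.1.2) := by fun_prop
  have hμ := Measure.isProbabilityMeasure_map (μ := P) hm1.aemeasurable
  calc _ = ∫ z, K z.1 * g (z.2 + k * z.1.2) ∂(P.map fun ω =>
        (((fun i => X (a i) ω - ρ (a i) / ρ s * X s ω), X s ω - ρ s / ρ r * X r ω),
          (X u ω - ρ u / ρ r * X r ω) - k * (X s ω - ρ s / ρ r * X r ω))) := by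
        rw [integral_map (hm1.prodMk hm2).aemeasurable hF.aestronglyMeasurable]
        simp
    _ = ∫ y, K y * (∫ x, g x * gaussianPDFReal (k * y.2)
          (condVar ρ q s u r).toNNReal x) ∂(P.map fun ω =>
        ((fun i => X (a i) ω - ρ (a i) / ρ s * X s ω), X s ω - ρ s / ρ r * X r ω)) := by
        rw [hind, integral_prod]
        · congr 1
          ext y
          have h1 : ∫ z, g (z + k * y.2) ∂gaussianReal 0 (condVar ρ q s u r).toNNReal =
              ∫ x, g x ∂gaussianReal (0 + k * y.2) (condVar ρ q s u r).toNNReal := by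
            rw [← gaussianReal_map_add_const, integral_map (by fun_prop)
              hg.aestronglyMeasurable]
          simp only [integral_const_mul]
          rw [h1, zero_add, integral_gaussianReal_eq_integral_smul hv]
          simp [mul_comm]
        · refine Integrable.of_bound hF.aestronglyMeasurable (C' * C) (.of_forall fun z => ?_)
          rw [norm_mul]
          exact mul_le_mul (hKC _) (hgC _) (norm_nonneg _) ((abs_nonneg _).trans (hKC z.1))
    _ = _ := by
        rw [integral_map hm1.aemeasurable]
        refine (hK.mul ?_).aestronglyMeasurable
        refine (StronglyMeasurable.integral_prod_right (Measurable.stronglyMeasurable ?_)).measurable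
        have h2 : Measurable fun z : ((ι → ℝ) × ℝ) × ℝ =>
            (k * z.1.2, (condVar ρ q s u r).toNNReal, z.2) := by fun_prop
        exact (hg.comp measurable_snd).mul (measurable_uncurry_gaussianPDFReal.comp h2)

/-- The values at times `t` of a bridge, recovered from its residuals up to time `s` and its value
at time `s`, when the bridge ends before the first of these times that exceeds `s`. -/
noncomputable def reconstruct {ι : Type*} (ρ : ℝ → ℝ) (t : ι → ℝ) (s : ℝ) (y : (ι → ℝ) × ℝ)
    (i : ι) : ℝ :=
  if t i ≤ s then y.1 i + ρ (t i) / ρ s * y.2 else 0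

lemma measurable_reconstruct {ι : Type*} (ρ : ℝ → ℝ) (t : ι → ℝ) (s : ℝ) :
    Measurable (reconstruct ρ t s) := by
  refine measurable_pi_lambda _ fun i => ?_
  unfold reconstruct
  split_ifs <;> fun_prop

lemma reconstruct_bridge (h : IsGaussMarkov P X ρ q) {ι : Type*} {t : ι → ℝ} (ht : ∀ i, 0 < t i)
    {s r : ℝ} (hs : 0 < s) (hsr : s < r) (htr : ∀ i, t i ≤ s ∨ r ≤ t i) (ω : Ω) :
    reconstruct ρ t s ((fun i => X (min (t i) s) ω - ρ (min (t i) s) / ρ s * X s ω),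
      bridge X ρ s r ω) = fun i => bridge X ρ (t i) r ω := by
  ext i
  unfold reconstruct
  split_ifs with hi
  · simp only [min_eq_left hi, bridge_of_lt hsr, bridge_of_lt (hi.trans_lt hsr)]
    have := (h.rho_pos s hs).ne'
    field_simp
    ring
  · rw [h.bridge_of_le (ht i) ((htr i).resolve_left hi)]

lemma measurable_uncurry_comp_snd {E : Type*} [MeasurableSpace E] {F : ℝ → ℝ → ℝ}
    (hF : Measurable (Function.uncurry F)) :
    Measurable (Function.uncurry fun r (y : E × ℝ) => F r y.2) :=
  hF.comp (measurable_fst.prodMk (measurable_snd.comp measurable_snd))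

lemma integrable_density (h : IsGaussMarkov P X ρ q) {ν : Measure ℝ} [IsFiniteMeasure ν]
    {E : Type*} [MeasurableSpace E] {κ : Measure E} [IsProbabilityMeasure κ] {s : ℝ} (hs : 0 < s)
    {J : Set ℝ} (hJ : MeasurableSet J) (hJs : J ⊆ Ioi s) :
    Integrable (Function.uncurry fun r (y : E × ℝ) => density ρ q s r y.2)
      ((ν.restrict J).prod (κ.prod volume)) := by
  have hm : Measurable (Function.uncurry fun r (y : E × ℝ) => density ρ q s r y.2) :=
    measurable_uncurry_comp_snd (h.measurable_density s)
  rw [integrable_prod_iff hm.aestronglyMeasurable]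
  constructor
  · exact .of_forall fun r =>
      (integrable_gaussianPDFReal 0 (bridgeVar ρ q s r).toNNReal).comp_snd κ
  · refine (integrable_const (1 : ℝ)).congr ?_
    filter_upwards [ae_restrict_mem hJ] with r hr
    have hv : (bridgeVar ρ q s r).toNNReal ≠ 0 := by simp [h.bridgeVar_pos hs (hJs hr)]
    have h1 : ∀ y : E × ℝ, ‖density ρ q s r y.2‖ = density ρ q s r y.2 := fun y =>
      Real.norm_of_nonneg (density_nonneg _ _ _ _ _)
    simp only [Function.uncurry, h1]
    rw [integral_fun_snd (μ := κ) (density ρ q s r)]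
    simp only [density, integral_gaussianPDFReal_eq_one _ hv]
    simp

/-- When the length of the bridge lies in `J`, functions of this length and of the value at
time `s` are predicted from the observed values by their posterior mean. -/
lemma setIntegral_posteriorMean (h : IsGaussMarkov P X ρ q) {ν : Measure ℝ} [IsFiniteMeasure ν]
    {ι : Type*} [Finite ι] {t : ι → ℝ} (ht : ∀ i, 0 < t i) {s : ℝ} (hs : 0 < s) {J : Set ℝ}
    (hJ : MeasurableSet J) (hJs : J ⊆ Ioi s) (hJt : ∀ r ∈ J, ∀ i, t i ≤ s ∨ r ≤ t i)
    {f : (ι → ℝ) → ℝ} (hf : Measurable f) {C' : ℝ} (hfC : ∀ y, |f y| ≤ C')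
    {G : ℝ → ℝ → ℝ} (hG : Measurable (Function.uncurry G)) {C : ℝ} (hC : 0 ≤ C)
    (hGC : ∀ r y, |G r y| ≤ C) :
    ∫ r in J, ∫ ω, f (fun i => bridge X ρ (t i) r ω) * G r (bridge X ρ s r ω) ∂P ∂ν =
      ∫ r in J, ∫ ω, f (fun i => bridge X ρ (t i) r ω) *
        posteriorMean (ν.restrict J) (density ρ q s) G (bridge X ρ s r ω) ∂P ∂ν := by
  have := h.gaussian.isProbabilityMeasure
  set a : ι → ℝ := fun i => min (t i) s
  have ha : ∀ i, 0 < a i ∧ a i ≤ s := fun i => ⟨lt_min (ht i) hs, min_le_right _ _⟩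
  set η := fun ω i => X (a i) ω - ρ (a i) / ρ s * X s ω with hη
  have hm : Measurable η :=
    measurable_pi_lambda _ fun i => (h.measurable _).sub ((h.measurable _).const_mul _)
  have := Measure.isProbabilityMeasure_map (μ := P) hm.aemeasurable
  have hfr := hf.comp (measurable_reconstruct ρ t s)
  have key : ∀ G : ℝ → ℝ → ℝ, Measurable (Function.uncurry G) →
      ∫ r in J, ∫ ω, f (fun i => bridge X ρ (t i) r ω) * G r (bridge X ρ s r ω) ∂P ∂ν =
        ∫ r in J, ∫ y, density ρ q s r y.2 * (f (reconstruct ρ t s y) * G r y.2)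
          ∂(P.map η).prod volume ∂ν := by
    intro G hG
    refine setIntegral_congr_fun hJ fun r hr => ?_
    have hGr : Measurable fun y : (ι → ℝ) × ℝ => G r y.2 :=
      hG.comp (measurable_const.prodMk measurable_snd)
    have := h.integral_bridge a ha hs (hJs hr) (hfr.mul hGr)
    simp only [Pi.mul_apply, Function.comp_apply] at this
    rw [← this]
    simp only [a, h.reconstruct_bridge ht hs (hJs hr) (hJt r hr)]
  rw [key G hG, key (fun _ => posteriorMean (ν.restrict J) (density ρ q s) G)
    ((measurable_posteriorMean (h.measurable_density s) hG).comp measurable_snd)]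
  have h1 := fun (hi : Integrable (Function.uncurry fun r (y : (ι → ℝ) × ℝ) =>
      density ρ q s r y.2) ((ν.restrict J).prod ((P.map η).prod volume))) =>
    integral_mul_posteriorMean (ν := ν.restrict J) (κ := (P.map η).prod volume)
      (K := fun y => f (reconstruct ρ t s y))
      (G := fun r (y : (ι → ℝ) × ℝ) => G r y.2) (φ := fun r y => density ρ q s r y.2)
      (fun r y => density_nonneg ρ q s r y.2)
      (measurable_uncurry_comp_snd (h.measurable_density s)) hi
      (measurable_uncurry_comp_snd hG) hC
      (fun r y => hGC r y.2) hfr fun y => hfC (reconstruct ρ t s y)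
  exact h1 (h.integrable_density (κ := P.map η) (ν := ν) hs hJ hJs)

/-- The mean of `g r` at the value of the bridge of length `r` at time `u`, given its value `x`
at time `s`. -/
noncomputable def futureMean (ρ q : ℝ → ℝ) (g : ℝ → ℝ → ℝ) (s u r x : ℝ) : ℝ :=
  if r ≤ u then g r 0 else
    ∫ y, g r y * gaussianPDFReal (slope ρ q s u r * x) (condVar ρ q s u r).toNNReal y

lemma measurable_futureMean (h : IsGaussMarkov P X ρ q) {g : ℝ → ℝ → ℝ}
    (hg : Measurable (Function.uncurry g)) (s u : ℝ) :
    Measurable (Function.uncurry (futureMean ρ q g s u)) := by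
  have h1 := h.continuous_rho.measurable
  have h2 := h.continuous_q.measurable
  refine Measurable.ite (measurable_fst measurableSet_Iic)
    (hg.comp (measurable_fst.prodMk measurable_const)) ?_
  have h3 : Measurable (slope ρ q s u) := by unfold slope; fun_prop
  have h4 : Measurable (condVar ρ q s u) := by unfold condVar; fun_prop
  refine (StronglyMeasurable.integral_prod_right (Measurable.stronglyMeasurable ?_)).measurable
  have h5 : Measurable fun z : (ℝ × ℝ) × ℝ =>
      (slope ρ q s u z.1.1 * z.1.2, (condVar ρ q s u z.1.1).toNNReal, z.2) := by fun_prop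
  have h6 : Measurable fun z : (ℝ × ℝ) × ℝ => g z.1.1 z.2 :=
    hg.comp ((measurable_fst.comp measurable_fst).prodMk measurable_snd)
  exact h6.mul (measurable_uncurry_gaussianPDFReal.comp h5)

lemma abs_futureMean_le {g : ℝ → ℝ → ℝ} {C : ℝ} (hC : 0 ≤ C) (hgC : ∀ r y, |g r y| ≤ C)
    (ρ q : ℝ → ℝ) (s u r x : ℝ) : |futureMean ρ q g s u r x| ≤ C := by
  unfold futureMean
  split_ifs
  · exact hgC _ _
  · generalize (condVar ρ q s u r).toNNReal = v
    have h1 : ∫ y, gaussianPDFReal (slope ρ q s u r * x) v y ≤ 1 := by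
      by_cases hv : v = 0
      · simp [hv]
      · exact (integral_gaussianPDFReal_eq_one _ hv).le
    refine le_trans ?_ (mul_le_of_le_one_right hC h1)
    rw [← integral_const_mul, ← Real.norm_eq_abs]
    refine norm_integral_le_of_norm_le ((integrable_gaussianPDFReal _ _).const_mul C)
      (.of_forall fun y => ?_)
    rw [norm_mul, Real.norm_of_nonneg (gaussianPDFReal_nonneg _ _ _)]
    exact mul_le_mul_of_nonneg_right (hgC r y) (gaussianPDFReal_nonneg _ _ _)

lemma integral_futureMean (h : IsGaussMarkov P X ρ q) {ι : Type*} [Finite ι] {t : ι → ℝ}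
    (ht : ∀ i, 0 < t i) {s u r : ℝ} (hs : 0 < s) (hts : ∀ i, t i ≤ s) (hsu : s < u) (hsr : s < r)
    {f : (ι → ℝ) → ℝ} (hf : Measurable f) {C' : ℝ} (hfC : ∀ y, |f y| ≤ C')
    {g : ℝ → ℝ → ℝ} (hg : Measurable (Function.uncurry g)) {C : ℝ} (hgC : ∀ r y, |g r y| ≤ C) :
    ∫ ω, f (fun i => bridge X ρ (t i) r ω) * g r (bridge X ρ u r ω) ∂P =
      ∫ ω, f (fun i => bridge X ρ (t i) r ω) *
        futureMean ρ q g s u r (bridge X ρ s r ω) ∂P := by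
  by_cases hru : r ≤ u
  · simp [futureMean, hru, h.bridge_of_le (hs.trans hsu) hru]
  · have := h.integral_bridge_future (fun i => min (t i) s)
      (fun i => ⟨lt_min (ht i) hs, min_le_right _ _⟩) hs hsu (not_le.1 hru)
      (hf.comp (measurable_reconstruct ρ t s)) (fun y => hfC _) (g := g r)
      (hg.comp measurable_prodMk_left) (hgC r)
    simpa [futureMean, hru, h.reconstruct_bridge ht hs hsr fun i => .inl (hts i)] using this

/-- The predictor of `g (length, bridge at u)` as a function of the values of a bridge of
random length at times `t 1 < ⋯ < t n`. -/
noncomputable def predictor (ν : Measure ℝ) (ρ q : ℝ → ℝ) (t : ℕ → ℝ) (n : ℕ) (u : ℝ)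
    (g : ℝ → ℝ → ℝ) (x : ℕ → ℝ) : ℝ :=
  (∫ r in Ioc 0 (t 1), g r 0 ∂ν) / ν.real (Iic (t 1)) * (if x 1 = 0 then 1 else 0)
    + ∑ k ∈ Finset.Icc 1 (n - 1),
        posteriorMean (ν.restrict (Ioc (t k) (t (k + 1)))) (density ρ q (t k))
          (fun r _ => g r 0) (x k) * (if x k ≠ 0 ∧ x (k + 1) = 0 then 1 else 0)
    + posteriorMean (ν.restrict (Ioi (t n))) (density ρ q (t n))
        (futureMean ρ q g (t n) u) (x n) * (if x n ≠ 0 then 1 else 0)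

lemma measurable_predictor (h : IsGaussMarkov P X ρ q) {ν : Measure ℝ} [IsFiniteMeasure ν]
    {t : ℕ → ℝ} {n : ℕ} (hn : 1 ≤ n) {u : ℝ} {g : ℝ → ℝ → ℝ}
    (hg : Measurable (Function.uncurry g)) {E : Type*} [MeasurableSpace E] {x : E → ℕ → ℝ}
    (hx : ∀ k ∈ Finset.Icc 1 n, Measurable fun y => x y k) :
    Measurable fun y => predictor ν ρ q t n u g (x y) := by
  have hz : ∀ k ∈ Finset.Icc 1 n, MeasurableSet {y | x y k = 0} := fun k hk =>
    hx k hk (measurableSet_singleton 0)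
  have hg0 : Measurable (Function.uncurry fun r (_ : ℝ) => g r 0) :=
    hg.comp (measurable_fst.prodMk measurable_const)
  refine Measurable.add (Measurable.add ?_ ?_) ?_
  · exact measurable_const.mul
      (Measurable.ite (hz 1 (by simp [hn])) measurable_const measurable_const)
  · refine Finset.measurable_fun_sum _ fun k hk => ?_
    have hk' := Finset.mem_Icc.1 hk
    have h1 : k ∈ Finset.Icc 1 n := Finset.mem_Icc.2 (by omega)
    have h2 : k + 1 ∈ Finset.Icc 1 n := Finset.mem_Icc.2 (by omega)
    refine Measurable.mul ?_ (Measurable.ite ((hz k h1).compl.inter (hz _ h2))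
      measurable_const measurable_const)
    exact (measurable_posteriorMean (h.measurable_density _) hg0).comp (hx k h1)
  · have h1 : n ∈ Finset.Icc 1 n := Finset.mem_Icc.2 (by omega)
    refine Measurable.mul ?_ (Measurable.ite (hz n h1).compl measurable_const measurable_const)
    exact (measurable_posteriorMean (h.measurable_density _)
      (h.measurable_futureMean hg _ _)).comp (hx n h1)

lemma exists_abs_predictor_le (ν : Measure ℝ) (ρ q : ℝ → ℝ) (t : ℕ → ℝ) (n : ℕ) (u : ℝ)
    {g : ℝ → ℝ → ℝ} {C : ℝ} (hC : 0 ≤ C) (hgC : ∀ r y, |g r y| ≤ C) :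
    ∃ C', ∀ x, |predictor ν ρ q t n u g x| ≤ C' := by
  have h1 : ∀ (a b : ℝ) (p : Prop) [Decidable p], |a| ≤ b → |a * (if p then 1 else 0)| ≤ b := by
    intro a b p _ hab
    split_ifs
    · simpa
    · simpa using (abs_nonneg a).trans hab
  refine ⟨|(∫ r in Ioc 0 (t 1), g r 0 ∂ν) / ν.real (Iic (t 1))|
    + ∑ _k ∈ Finset.Icc 1 (n - 1), C + C, fun x => ?_⟩
  unfold predictor
  refine (abs_add_le _ _).trans (add_le_add ((abs_add_le _ _).trans (add_le_add ?_ ?_)) ?_)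
  · exact h1 _ _ _ le_rfl
  · refine (Finset.abs_sum_le_sum_abs _ _).trans (Finset.sum_le_sum fun k _ => h1 _ _ _ ?_)
    exact abs_posteriorMean_le (density_nonneg _ _ _) (fun _ _ => hgC _ _) hC _
  · refine h1 _ _ _ ?_
    exact abs_posteriorMean_le (density_nonneg _ _ _) (abs_futureMean_le hC hgC _ _ _ _) hC _

end IsGaussMarkov

namespace IsGaussMarkov

section Predictor

variable {ν : Measure ℝ} {ρ q : ℝ → ℝ} {t : ℕ → ℝ} {n : ℕ} {u : ℝ} {g : ℝ → ℝ → ℝ} {x : ℕ → ℝ}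

lemma predictor_of_eq_zero (hn : 1 ≤ n) (hx : ∀ i ∈ Finset.Icc 1 n, x i = 0) :
    predictor ν ρ q t n u g x = (∫ r in Ioc 0 (t 1), g r 0 ∂ν) / ν.real (Iic (t 1)) := by
  have h1 : ∀ k ∈ Finset.Icc 1 (n - 1), x k = 0 := fun k hk =>
    hx k (Finset.mem_Icc.2 (by have := Finset.mem_Icc.1 hk; omega))
  unfold predictor
  rw [Finset.sum_eq_zero fun k hk => by simp [h1 k hk], hx 1 (by simp [hn]), hx n (by simp [hn])]
  simp

lemma predictor_of_eq_zero_iff_lt {k : ℕ} (hk : k ∈ Finset.Icc 1 (n - 1))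
    (hx : ∀ i ∈ Finset.Icc 1 n, x i = 0 ↔ k < i) :
    predictor ν ρ q t n u g x = posteriorMean (ν.restrict (Ioc (t k) (t (k + 1))))
      (density ρ q (t k)) (fun r _ => g r 0) (x k) := by
  have hk' := Finset.mem_Icc.1 hk
  have hx' : ∀ i, 1 ≤ i → i ≤ n → (x i = 0 ↔ k < i) := fun i h1 h2 =>
    hx i (Finset.mem_Icc.2 ⟨h1, h2⟩)
  have h1 : x 1 ≠ 0 := fun h => by have := (hx' 1 le_rfl (by omega)).1 h; omega
  have h2 : x n = 0 := (hx' n (by omega) le_rfl).2 (by omega)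
  unfold predictor
  rw [Finset.sum_eq_single k]
  · have h3 : x k ≠ 0 := fun h => by have := (hx' k (by omega) (by omega)).1 h; omega
    have h4 : x (k + 1) = 0 := (hx' _ (by omega) (by omega)).2 (by omega)
    simp [h1, h2, h3, h4]
  · intro i hi hik
    have hi' := Finset.mem_Icc.1 hi
    have h3 := hx' i (by omega) (by omega)
    have h4 := hx' (i + 1) (by omega) (by omega)
    rw [if_neg, mul_zero]
    rintro ⟨h5, h6⟩
    have h7 := h4.1 h6
    exact h5 (h3.2 (by omega))
  · exact fun h => absurd hk h

lemma predictor_of_ne_zero (hn : 1 ≤ n) (hx : ∀ i ∈ Finset.Icc 1 n, x i ≠ 0) :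
    predictor ν ρ q t n u g x = posteriorMean (ν.restrict (Ioi (t n))) (density ρ q (t n))
      (futureMean ρ q g (t n) u) (x n) := by
  unfold predictor
  rw [Finset.sum_eq_zero, if_neg (hx 1 (by simp [hn])), if_pos (hx n (by simp [hn]))]
  · simp
  · intro k hk
    have := hx (k + 1) (Finset.mem_Icc.2 (by have := Finset.mem_Icc.1 hk; omega))
    simp [this]

end Predictor

variable {Ω : Type*} [MeasurableSpace Ω] {P : Measure Ω} {X : ℝ → Ω → ℝ} {ρ q : ℝ → ℝ}

/-- Prediction formula for a bridge whose length is independent of the underlying process,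
tested against functions of the values at times `t 1 < ⋯ < t n`. -/
theorem integral_mul_predictor (h : IsGaussMarkov P X ρ q) {ν : Measure ℝ}
    [IsProbabilityMeasure ν] (hν : ∀ᵐ r ∂ν, 0 < r) {n : ℕ} (hn : 1 ≤ n) {t : ℕ → ℝ}
    (ht : ∀ i j, 1 ≤ i → i < j → j ≤ n → t i < t j) (ht1 : 0 < t 1)
    (hν1 : ν.real (Iic (t 1)) ≠ 0) {u : ℝ} (hu : t n < u)
    {f : (Finset.Icc 1 n → ℝ) → ℝ} (hf : Measurable f) {C' : ℝ} (hfC : ∀ y, |f y| ≤ C')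
    {g : ℝ → ℝ → ℝ} (hg : Measurable (Function.uncurry g)) {C : ℝ} (hC : 0 ≤ C)
    (hgC : ∀ r y, |g r y| ≤ C) :
    ∫ z, f (fun i => bridge X ρ (t i) z.1 z.2) * g z.1 (bridge X ρ u z.1 z.2) ∂ν.prod P =
      ∫ z, f (fun i => bridge X ρ (t i) z.1 z.2) *
        predictor ν ρ q t n u g (fun k => bridge X ρ (t k) z.1 z.2) ∂ν.prod P := by
  have := h.gaussian.isProbabilityMeasure
  have hmono : ∀ i j, 1 ≤ i → i ≤ j → j ≤ n → t i ≤ t j := fun i j h1 h2 h3 =>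
    h2.eq_or_lt.elim (fun h => h ▸ le_rfl) fun h => (ht i j h1 h h3).le
  have hpos : ∀ i, 1 ≤ i → i ≤ n → 0 < t i := fun i h1 h2 => ht1.trans_le (hmono 1 i le_rfl h1 h2)
  have hpos' : ∀ i : Finset.Icc 1 n, 0 < t i := fun i =>
    hpos i (Finset.mem_Icc.1 i.2).1 (Finset.mem_Icc.1 i.2).2
  have hfm : Measurable fun z : ℝ × Ω => f fun i => bridge X ρ (t i) z.1 z.2 :=
    hf.comp (measurable_pi_lambda _ fun i => h.measurable_bridge (t i))
  have hinteg : ∀ H : ℝ × Ω → ℝ, Measurable H → (∃ D, ∀ z, |H z| ≤ D) →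
      Integrable (fun z => f (fun i => bridge X ρ (t i) z.1 z.2) * H z) (ν.prod P) := by
    rintro H hH ⟨D, hD⟩
    refine Integrable.of_bound (hfm.mul hH).aestronglyMeasurable (C' * D) (.of_forall fun z => ?_)
    rw [norm_mul]
    exact mul_le_mul (hfC _) (hD _) (norm_nonneg _) ((abs_nonneg _).trans (hfC fun _ => 0))
  have hi1 := hinteg (fun z => g z.1 (bridge X ρ u z.1 z.2))
    (hg.comp (measurable_fst.prodMk (h.measurable_bridge u))) ⟨C, fun z => hgC _ _⟩
  have hi2 := hinteg (fun z => predictor ν ρ q t n u g (fun k => bridge X ρ (t k) z.1 z.2))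
    (h.measurable_predictor hn hg fun k _ => h.measurable_bridge (t k))
    ((exists_abs_predictor_le ν ρ q t n u hC hgC).imp fun D hD z => hD _)
  rw [integral_prod _ hi1, integral_prod _ hi2]
  replace hi1 := hi1.integral_prod_left
  replace hi2 := hi2.integral_prod_left
  set I1 := fun r => ∫ ω, f (fun i => bridge X ρ (t i) r ω) * g r (bridge X ρ u r ω) ∂P with hI1
  set I2 := fun r => ∫ ω, f (fun i => bridge X ρ (t i) r ω) *
    predictor ν ρ q t n u g (fun k => bridge X ρ (t k) r ω) ∂P with hI2
  have hg0 : Measurable (Function.uncurry fun r (_ : ℝ) => g r 0) :=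
    hg.comp (measurable_fst.prodMk measurable_const)
  have hae : ∀ r, ∀ᵐ ω ∂P, ∀ i ∈ Finset.Icc 1 n, bridge X ρ (t i) r ω = 0 ↔ r ≤ t i := by
    intro r
    have := ae_all_iff.2 fun i : Finset.Icc 1 n => h.ae_bridge_eq_zero_iff (hpos' i) r
    exact this.mono fun ω hω i hi => hω ⟨i, hi⟩
  have hstart : ∫ r in Iic (t 1), I1 r ∂ν = ∫ r in Iic (t 1), I2 r ∂ν := by
    have h0 : ∀ r ≤ t 1, ∀ i ∈ Finset.Icc 1 n, ∀ ω, bridge X ρ (t i) r ω = 0 := fun r hr i hi ω =>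
      h.bridge_of_le (hpos' ⟨i, hi⟩)
        (hr.trans (hmono 1 i le_rfl (Finset.mem_Icc.1 hi).1 (Finset.mem_Icc.1 hi).2)) ω
    have h1 : ∀ r ∈ Iic (t 1), I1 r = f (fun _ => 0) * g r 0 := by
      intro r hr
      have : ∀ ω, bridge X ρ u r ω = 0 := h.bridge_of_le ((hpos n hn le_rfl).trans hu)
        (hr.trans ((hmono 1 n le_rfl hn le_rfl).trans hu.le))
      simp only [hI1, this, fun (i : Finset.Icc 1 n) ω => h0 r hr i i.2 ω]
      simp
    have h2 : ∀ r ∈ Iic (t 1), I2 r =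
        f (fun _ => 0) * ((∫ r in Ioc 0 (t 1), g r 0 ∂ν) / ν.real (Iic (t 1))) := by
      intro r hr
      simp only [hI2, fun (i : Finset.Icc 1 n) ω => h0 r hr i i.2 ω,
        fun ω => predictor_of_eq_zero (ν := ν) (ρ := ρ) (q := q) (t := t) (u := u) (g := g) hn
          fun i hi => h0 r hr i hi ω]
      simp
    rw [setIntegral_congr_fun measurableSet_Iic h1, setIntegral_congr_fun measurableSet_Iic h2,
      integral_const_mul, setIntegral_const, smul_eq_mul]
    have h3 : (Iic (t 1) : Set ℝ) =ᵐ[ν] Ioc 0 (t 1) :=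
      hν.mono fun r hr => propext ⟨fun h => ⟨hr, h⟩, fun h => h.2⟩
    rw [setIntegral_congr_set h3]
    field_simp
  have hstep : ∀ k, 1 ≤ k → k + 1 ≤ n →
      ∫ r in Ioc (t k) (t (k + 1)), I1 r ∂ν = ∫ r in Ioc (t k) (t (k + 1)), I2 r ∂ν := by
    intro k hk hkn
    have hlt : ∀ r ∈ Ioc (t k) (t (k + 1)), ∀ i ∈ Finset.Icc 1 n, r ≤ t i ↔ k < i := by
      intro r hr i hi
      rw [Finset.mem_Icc] at hi
      refine ⟨fun h => ?_, fun h => hr.2.trans (hmono _ _ (by omega) h hi.2)⟩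
      by_contra! hik
      exact (hr.1.trans_le (h.trans (hmono _ _ hi.1 hik (by omega)))).false
    have h1 := h.setIntegral_posteriorMean (ν := ν) hpos' (hpos k hk (by omega))
      (J := Ioc (t k) (t (k + 1))) measurableSet_Ioc (fun r hr => hr.1)
      (fun r hr i => (le_or_gt (i : ℕ) k).imp
        (fun hi => hmono _ _ (Finset.mem_Icc.1 i.2).1 hi (by omega)) fun hi => (hlt r hr i i.2).2 hi)
      hf hfC hg0 hC fun r _ => hgC r 0
    convert h1 using 1
    · refine setIntegral_congr_fun measurableSet_Ioc fun r hr => ?_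
      have : ∀ ω, bridge X ρ u r ω = 0 := h.bridge_of_le ((hpos n hn le_rfl).trans hu)
        (hr.2.trans ((hmono _ n (by omega) hkn le_rfl).trans hu.le))
      simp only [hI1, this]
    · refine setIntegral_congr_fun measurableSet_Ioc fun r hr => ?_
      refine integral_congr_ae ((hae r).mono fun ω hω => ?_)
      have := predictor_of_eq_zero_iff_lt (ν := ν) (ρ := ρ) (q := q) (t := t) (u := u) (g := g)
        (k := k) (n := n) (x := fun k => bridge X ρ (t k) r ω) (Finset.mem_Icc.2 ⟨hk, by omega⟩)
        fun i hi => (hω i hi).trans (hlt r hr i hi)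
      simp only [this]
  have hend : ∫ r in Ioi (t n), I1 r ∂ν = ∫ r in Ioi (t n), I2 r ∂ν := by
    have hle : ∀ i : Finset.Icc 1 n, t i ≤ t n := fun i =>
      hmono _ _ (Finset.mem_Icc.1 i.2).1 (Finset.mem_Icc.1 i.2).2 le_rfl
    have h1 := h.setIntegral_posteriorMean (ν := ν) hpos' (hpos n hn le_rfl)
      (J := Ioi (t n)) measurableSet_Ioi subset_rfl (fun r _ i => .inl (hle i))
      hf hfC (h.measurable_futureMean hg (t n) u) hC (abs_futureMean_le hC hgC _ _ _ _)
    convert h1 using 1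
    · refine setIntegral_congr_fun measurableSet_Ioi fun r hr => ?_
      exact h.integral_futureMean hpos' (hpos n hn le_rfl) hle hu hr hf hfC hg hgC
    · refine setIntegral_congr_fun measurableSet_Ioi fun r hr => ?_
      refine integral_congr_ae ((hae r).mono fun ω hω => ?_)
      have := predictor_of_ne_zero (ν := ν) (ρ := ρ) (q := q) (t := t) (u := u) (g := g)
        (n := n) (x := fun k => bridge X ρ (t k) r ω) hn
        fun i hi => (hω i hi).not.2 ((hle ⟨i, hi⟩).trans_lt hr).not_ge
      simp only [this]
  have hIic : ∀ m, 1 ≤ m → m ≤ n → ∫ r in Iic (t m), I1 r ∂ν = ∫ r in Iic (t m), I2 r ∂ν := by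
    intro m hm
    induction m, hm using Nat.le_induction with
    | base => exact fun _ => hstart
    | succ k hk ih =>
      intro hkn
      rw [← Iic_union_Ioc_eq_Iic (ht k (k + 1) hk (by omega) hkn).le]
      have hd : Disjoint (Iic (t k)) (Ioc (t k) (t (k + 1))) :=
        Set.disjoint_left.2 fun r h1 h2 => h2.1.not_ge h1
      rw [setIntegral_union hd measurableSet_Ioc hi1.integrableOn hi1.integrableOn,
        setIntegral_union hd measurableSet_Ioc hi2.integrableOn hi2.integrableOn,
        ih (by omega), hstep k hk hkn]
  rw [← integral_add_compl (measurableSet_Iic (a := t n)) hi1,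
    ← integral_add_compl (measurableSet_Iic (a := t n)) hi2, compl_Iic, hIic n hn le_rfl, hend]

end IsGaussMarkov

lemma iSup_comap_eq_comap_restrict {Ω κ : Type*} (I : Finset κ) (Y : κ → Ω → ℝ) :
    ⨆ k ∈ I, MeasurableSpace.comap (Y k) inferInstance =
      MeasurableSpace.comap (fun ω (i : I) => Y i ω) inferInstance := by
  rw [iSup_subtype']
  change _ = MeasurableSpace.comap _ MeasurableSpace.pi
  simp only [MeasurableSpace.pi, MeasurableSpace.comap_iSup, MeasurableSpace.comap_comp]
  rfl

namespace IsGaussMarkov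

/-- The conditional expectation of a function of the length and of the value at time `u` of a
bridge of random length, given its values at earlier times. -/
theorem condExp_bridge {Ω Ω' : Type*} [MeasurableSpace Ω] [MeasurableSpace Ω'] {P : Measure Ω}
    [IsProbabilityMeasure P] {Z : Ω → Ω'} (hZ : Measurable Z) {X : ℝ → Ω' → ℝ} {ρ q : ℝ → ℝ}
    (h : IsGaussMarkov (P.map Z) X ρ q) {τ : Ω → ℝ} (hτ : Measurable τ) (hτ0 : ∀ ω, 0 < τ ω)
    (hind : IndepFun τ Z P) {n : ℕ} (hn : 1 ≤ n) {t : ℕ → ℝ}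
    (ht : ∀ i j, 1 ≤ i → i < j → j ≤ n → t i < t j) (ht1 : 0 < t 1)
    (hτ1 : (P.map τ).real (Iic (t 1)) ≠ 0) {u : ℝ} (hu : t n < u)
    {g : ℝ → ℝ → ℝ} (hg : Measurable (Function.uncurry g)) {C : ℝ} (hgC : ∀ r y, |g r y| ≤ C) :
    P[fun ω => g (τ ω) (bridge X ρ u (τ ω) (Z ω)) | ⨆ k ∈ Finset.Icc 1 n,
        MeasurableSpace.comap (fun ω => bridge X ρ (t k) (τ ω) (Z ω)) inferInstance] =ᵐ[P]
      fun ω => predictor (P.map τ) ρ q t n u g fun k => bridge X ρ (t k) (τ ω) (Z ω) := by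
  have hC : 0 ≤ C := (abs_nonneg _).trans (hgC 0 0)
  have := Measure.isProbabilityMeasure_map (μ := P) hτ.aemeasurable
  have := Measure.isProbabilityMeasure_map (μ := P) hZ.aemeasurable
  have hZτ : Measurable fun ω => (τ ω, Z ω) := hτ.prodMk hZ
  have hlaw := hind.map_prod_eq_prod_map_map hτ.aemeasurable hZ.aemeasurable
  have hb : ∀ s, Measurable fun ω => bridge X ρ s (τ ω) (Z ω) := fun s =>
    (h.measurable_bridge s).comp hZτ
  set Ξ : Ω → Finset.Icc 1 n → ℝ := fun ω i => bridge X ρ (t i) (τ ω) (Z ω) with hΞ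
  have hΞm : Measurable Ξ := measurable_pi_lambda _ fun i => hb (t i)
  rw [iSup_comap_eq_comap_restrict (Finset.Icc 1 n) fun k ω => bridge X ρ (t k) (τ ω) (Z ω)]
  have hpm : Measurable[MeasurableSpace.comap Ξ inferInstance] fun ω =>
      predictor (P.map τ) ρ q t n u g fun k => bridge X ρ (t k) (τ ω) (Z ω) :=
    @measurable_predictor _ _ _ _ _ _ h _ _ _ _ hn _ _ hg _
      (MeasurableSpace.comap Ξ inferInstance) _
      fun k hk => (measurable_pi_apply (⟨k, hk⟩ : Finset.Icc 1 n)).comp (comap_measurable Ξ)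
  obtain ⟨D, hD⟩ := exists_abs_predictor_le (P.map τ) ρ q t n u hC hgC
  have hgm : Measurable fun ω => g (τ ω) (bridge X ρ u (τ ω) (Z ω)) :=
    hg.comp (hτ.prodMk (hb u))
  refine (ae_eq_condExp_of_forall_setIntegral_eq hΞm.comap_le
    (.of_bound hgm.aestronglyMeasurable C (.of_forall fun ω => hgC _ _))
    (fun s _ _ => Integrable.integrableOn (.of_bound
      (hpm.mono hΞm.comap_le le_rfl).aestronglyMeasurable D
      (.of_forall fun ω => hD _))) ?_ hpm.stronglyMeasurable.aestronglyMeasurable).symm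
  intro s hs _
  obtain ⟨S, hS, rfl⟩ := hs
  have hset : ∀ H : Ω → ℝ, ∫ ω in Ξ ⁻¹' S, H ω ∂P = ∫ ω, S.indicator 1 (Ξ ω) * H ω ∂P := by
    intro H
    rw [← integral_indicator (hΞm hS)]
    congr 1
    ext ω
    by_cases hω : Ξ ω ∈ S <;> simp [hω]
  have hprod : ∀ H : ℝ × Ω' → ℝ, Measurable H →
      ∫ z, H z ∂(P.map τ).prod (P.map Z) = ∫ ω, H (τ ω, Z ω) ∂P := by
    intro H hH
    rw [← hlaw, integral_map hZτ.aemeasurable hH.aestronglyMeasurable]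
  have hfm : Measurable (S.indicator (1 : (Finset.Icc 1 n → ℝ) → ℝ)) :=
    measurable_one.indicator hS
  have hfm' : Measurable fun z : ℝ × Ω' => S.indicator (1 : (Finset.Icc 1 n → ℝ) → ℝ)
      fun i => bridge X ρ (t i) z.1 z.2 :=
    hfm.comp (measurable_pi_lambda _ fun i => h.measurable_bridge (t i))
  have hcore := h.integral_mul_predictor (ν := P.map τ)
    ((ae_map_iff hτ.aemeasurable measurableSet_Ioi).2 (.of_forall hτ0)) hn ht ht1 hτ1 hu
    (f := S.indicator 1) hfm (C' := 1)
    (fun y => by by_cases hy : y ∈ S <;> simp [hy]) hg hC hgC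
  have h1 := hprod _ (hfm'.mul (hg.comp (measurable_fst.prodMk (h.measurable_bridge u))))
  have h2 := hprod _ (hfm'.mul (h.measurable_predictor (ν := P.map τ) (t := t) (u := u) hn hg
    fun k _ => h.measurable_bridge (t k)))
  rw [hset, hset]
  exact h2.symm.trans (hcore.symm.trans h1)

/-- A criterion for being Gauss-Markov in terms of linear combinations. -/
lemma of_map_sum_eq_gaussianReal {Ω : Type*} [MeasurableSpace Ω] {P : Measure Ω}
    [IsProbabilityMeasure P] {X : ℝ → Ω → ℝ} {ρ q : ℝ → ℝ}
    (hX : ∀ t, Measurable (X t)) (hXc : ∀ ω, Continuous fun t => X t ω)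
    (hlin : ∀ (m : ℕ) (s : Fin m → ℝ) (c : Fin m → ℝ),
      ∃ v, P.map (fun ω => ∑ i, c i * X (s i) ω) = gaussianReal 0 v)
    (hcov : ∀ s t, 0 < s → s ≤ t → ∫ ω, X s ω * X t ω ∂P = ρ s * q t)
    (hρ : Continuous ρ) (hq : Continuous q) (hρ0 : ∀ t, 0 < t → 0 < ρ t)
    (hq0 : ∀ t, 0 < t → 0 < q t) (hdet : ∀ s t, 0 < s → s < t → 0 < ρ t * q s - ρ s * q t) :
    IsGaussMarkov P X ρ q := by
  have hmean : ∀ t, ∫ ω, X t ω ∂P = 0 := by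
    intro t
    obtain ⟨v, hv⟩ := hlin 1 (fun _ => t) fun _ => 1
    simp only [Finset.univ_unique, one_mul, Finset.sum_const, Finset.card_singleton,
      one_smul] at hv
    rw [← integral_map (f := fun x => x) (hX t).aemeasurable (by fun_prop)]
    exact (congrArg (fun μ => ∫ x, x ∂μ) hv).trans integral_id_gaussianReal
  have hg : IsGaussianProcess X P := by
    refine ⟨fun I => ⟨isGaussian_of_map_eq_gaussianReal fun L => ?_⟩⟩
    have hm : Measurable fun ω => I.restrict (X · ω) := measurable_pi_lambda _ fun i => hX i
    obtain ⟨v, hv⟩ := hlin I.card (fun i => (I.equivFin.symm i : ℝ))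
      fun i => L (Pi.single (I.equivFin.symm i) 1)
    refine ⟨0, v, ?_⟩
    rw [Measure.map_map L.continuous.measurable hm, ← hv]
    congr 1
    ext ω
    have h1 := L.toLinearMap.pi_apply_eq_sum_univ (I.restrict (X · ω))
    simp only [ContinuousLinearMap.coe_coe] at h1
    rw [Function.comp_apply, h1, ← I.equivFin.symm.sum_comp]
    refine Finset.sum_congr rfl fun i _ => ?_
    rw [smul_eq_mul, mul_comm, Finset.restrict]
    congr 2
    ext j
    simp [Pi.single_apply, eq_comm]
  refine ⟨hX, hXc, hg, hmean, fun s t hs hst => ?_, hρ, hq, hρ0, hq0, hdet⟩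
  rw [covariance_eq_sub (hg.hasGaussianLaw_eval s).memLp_two (hg.hasGaussianLaw_eval t).memLp_two,
    hmean, hmean, ← hcov s t hs hst]
  simp

end IsGaussMarkov

lemma setIntegral_mul_div_setIntegral {α E : Type*} [MeasurableSpace α] {ν : Measure α} {J : Set α}
    (hJ : MeasurableSet J) {φ : α → E → ℝ} {w G : α → ℝ} {x : E} {a : ℝ} (ha : a ≠ 0)
    (hw : ∀ r ∈ J, w r = a * φ r x) :
    ∫ r in J, G r * (w r / ∫ s in J, w s ∂ν) ∂ν =
      posteriorMean (ν.restrict J) φ (fun r _ => G r) x := by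
  rw [setIntegral_congr_fun hJ hw, integral_const_mul, posteriorMean, ← integral_div]
  refine setIntegral_congr_fun hJ fun r hr => ?_
  simp only [hw r hr]
  rw [mul_div_mul_left _ _ ha, mul_div_assoc]

namespace IsGaussMarkov

variable {Ω : Type*} [MeasurableSpace Ω] {P : Measure Ω} {X : ℝ → Ω → ℝ} {ρ q : ℝ → ℝ}

lemma sqrt_mul_exp_eq_mul_density (h : IsGaussMarkov P X ρ q) {s r c d : ℝ} (hs : 0 < s)
    (hsr : s < r) (hc : c = (bridgeVar ρ q s r)⁻¹ + d) (x : ℝ) :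
    √(ρ r / (ρ r * q s - ρ s * q r)) * exp (-(1 / 2) * c * x ^ 2) =
      √(2 * π * ρ s) * exp (-(1 / 2) * d * x ^ 2) * density ρ q s r x := by
  have h1 := h.rho_pos s hs
  have h2 := h.rho_pos r (hs.trans hsr)
  have h3 := h.det_pos s r hs hsr
  have hv := h.bridgeVar_pos hs hsr
  have h4 : ρ r / (ρ r * q s - ρ s * q r) = 2 * π * ρ s / (2 * π * bridgeVar ρ q s r) := by
    unfold bridgeVar
    field_simp
  have h5 : -(1 / 2) * c * x ^ 2 =
      -(1 / 2) * d * x ^ 2 + -(x - 0) ^ 2 / (2 * bridgeVar ρ q s r) := by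
    rw [hc]
    field_simp
    ring
  rw [density, gaussianPDFReal, Real.coe_toNNReal _ hv.le, h4, h5, exp_add,
    sqrt_div (by positivity)]
  ring

lemma setIntegral_add_setIntegral_eq_posteriorMean (ρ q : ℝ → ℝ) {ν : Measure ℝ} {s u : ℝ}
    (hsu : s < u) {G : ℝ → ℝ → ℝ} (hG : Measurable (Function.uncurry G)) {C : ℝ}
    (hGC : ∀ r y, |G r y| ≤ C) (x : ℝ) :
    ∫ r in Ioc s u, G r x * (density ρ q s r x / ∫ r in Ioi s, density ρ q s r x ∂ν) ∂ν +
      ∫ r in Ioi u, G r x * (density ρ q s r x / ∫ r in Ioi s, density ρ q s r x ∂ν) ∂ν =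
    posteriorMean (ν.restrict (Ioi s)) (density ρ q s) G x := by
  by_cases hi : IntegrableOn (fun r => density ρ q s r x) (Ioi s) ν
  · have hi' : IntegrableOn
        (fun r => G r x * (density ρ q s r x / ∫ r in Ioi s, density ρ q s r x ∂ν)) (Ioi s) ν := by
      refine Integrable.bdd_mul (c := C) (hi.div_const _) ?_ (.of_forall fun r => hGC r x)
      exact (hG.comp measurable_prodMk_right).aestronglyMeasurable
    rw [← setIntegral_union (Set.disjoint_left.2 fun r h1 h2 => h1.2.not_gt h2) measurableSet_Ioi
      (hi'.mono_set Ioc_subset_Ioi_self) (hi'.mono_set (Ioi_subset_Ioi hsu.le)),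
      Ioc_union_Ioi_eq_Ioi hsu.le, posteriorMean, ← integral_div]
    simp only [mul_div_assoc]
  · simp [posteriorMean, integral_undef hi]

/-- The coordinate process on the space of continuous paths. -/
def coordinate (t : ℝ) (x : {x : ℝ → ℝ // Continuous x}) : ℝ := x.1 t

/-- Extending a continuous Gaussian process from `[0, ∞)` to the line by its value at `0`, and
viewing it as a random continuous path, gives a Gauss-Markov coordinate process. -/
lemma exists_path {Ω : Type*} [MeasurableSpace Ω] {P : Measure Ω} [IsProbabilityMeasure P]
    {X : ℝ → Ω → ℝ} (hX : ∀ t, Measurable (X t))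
    (hXc : ∀ ω, ContinuousOn (fun t => X t ω) (Ici 0))
    (hlin : ∀ (m : ℕ) (s : Fin m → ℝ), (∀ i, 0 ≤ s i) → ∀ c : Fin m → ℝ,
      ∃ v, P.map (fun ω => ∑ i, c i * X (s i) ω) = gaussianReal 0 v) {ρ q : ℝ → ℝ}
    (hcov : ∀ s t, 0 < s → s ≤ t → ∫ ω, X s ω * X t ω ∂P = ρ s * q t)
    (hρ : Continuous ρ) (hq : Continuous q) (hρ0 : ∀ t, 0 < t → 0 < ρ t)
    (hq0 : ∀ t, 0 < t → 0 < q t) (hdet : ∀ s t, 0 < s → s < t → 0 < ρ t * q s - ρ s * q t) :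
    ∃ Z : Ω → {x : ℝ → ℝ // Continuous x}, Measurable Z ∧
      MeasurableSpace.comap Z inferInstance ≤
        ⨆ t ∈ Ici (0 : ℝ), MeasurableSpace.comap (X t) inferInstance ∧
      (∀ t, 0 ≤ t → ∀ ω, coordinate t (Z ω) = X t ω) ∧
      IsGaussMarkov (P.map Z) coordinate ρ q := by
  let Z : Ω → {x : ℝ → ℝ // Continuous x} := fun ω => ⟨fun t => X (max t 0) ω,
    (hXc ω).comp_continuous (by fun_prop) fun t => le_max_right t 0⟩
  have hZ : Measurable Z := (measurable_pi_lambda _ fun t => hX _).subtype_mk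
  have heval : ∀ t, Measurable (coordinate t) := fun t =>
    (measurable_pi_apply t).comp measurable_subtype_coe
  refine ⟨Z, hZ, ?_, fun t ht ω => by simp [coordinate, Z, ht], ?_⟩
  · change MeasurableSpace.comap Z (MeasurableSpace.comap Subtype.val MeasurableSpace.pi) ≤ _
    simp only [MeasurableSpace.pi, MeasurableSpace.comap_iSup, MeasurableSpace.comap_comp]
    exact iSup_le fun t => le_iSup₂_of_le (max t 0) (le_max_right t 0) le_rfl
  · have := Measure.isProbabilityMeasure_map (μ := P) hZ.aemeasurable
    refine of_map_sum_eq_gaussianReal heval (fun x => x.2) (fun m s c => ?_)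
      (fun s t hs hst => ?_) hρ hq hρ0 hq0 hdet
    · obtain ⟨v, hv⟩ := hlin m (fun i => max (s i) 0) (fun i => le_max_right _ _) c
      refine ⟨v, ?_⟩
      rw [Measure.map_map (Finset.measurable_fun_sum _ fun i _ => (heval _).const_mul _) hZ, ← hv]
      rfl
    · rw [integral_map hZ.aemeasurable
        (Measurable.mul (heval s) (heval t) : Measurable fun x => _ * _).aestronglyMeasurable,
        ← hcov s t hs hst]
      simp [coordinate, Z, hs.le, (hs.le.trans hst)]

end IsGaussMarkov

/-- Multi-time prediction formula: for 0 < t_1 < … < t_n < u with F(t_1) > 0 and 𝔤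
bounded measurable, E[𝔤(τ, ξ_u) | σ(ξ_{t_1}, …, ξ_{t_n})] has the explicit four-part form. -/
theorem stmt_13
    {Ω : Type*} [MeasurableSpace Ω] (P : Measure Ω) [IsProbabilityMeasure P]
    (X : ℝ → Ω → ℝ)
    (hXmeas : ∀ t, Measurable (X t))
    (hGauss : ∀ (m : ℕ) (ts : Fin m → ℝ), (∀ i, 0 ≤ ts i) → ∀ c : Fin m → ℝ,
      ∃ v : NNReal, Measure.map (fun ω => ∑ i, c i * X (ts i) ω) P = gaussianReal 0 v)
    (hXcont : ∀ ω, ContinuousOn (fun t => X t ω) (Set.Ici 0))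
    (hX0 : ∀ᵐ ω ∂P, X 0 ω = 0)
    (R : ℝ → ℝ → ℝ)
    (hR : ∀ s t, R s t = ∫ ω, X s ω * X t ω ∂P)
    (hRpos : ∀ t, 0 < t → 0 < R t t)
    (hRnd : ∀ s t, 0 < s → 0 < t → s ≠ t → (R s t)^2 < R s s * R t t)
    (ξr : ℝ → ℝ → Ω → ℝ)
    (hξr : ∀ r t ω, ξr r t ω = X t ω - R t (max r t) / R (max r t) (max r t) * X (max r t) ω)
    (τ : Ω → ℝ) (hτmeas : Measurable τ) (hτpos : ∀ ω, 0 < τ ω)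
    (hindep : Indep (MeasurableSpace.comap τ inferInstance)
      (⨆ t ∈ Set.Ici (0:ℝ), MeasurableSpace.comap (X t) inferInstance) P)
    (F : ℝ → ℝ) (hF : ∀ t, F t = (P {ω | τ ω ≤ t}).toReal)
    (ξ : ℝ → Ω → ℝ) (hξ : ∀ t ω, ξ t ω = ξr (τ ω) t ω)
    (ρ q : ℝ → ℝ)
    (hfact : ∀ s t, 0 ≤ s → 0 ≤ t → R s t = ρ (min s t) * q (max s t))
    (hρcont : ContinuousOn ρ (Set.Ici 0)) (hqcont : ContinuousOn q (Set.Ici 0))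
    (hρ0 : ρ 0 = 0)
    (hρpos : ∀ t, 0 < t → 0 < ρ t) (hqpos : ∀ t, 0 < t → 0 < q t)
    (hρq : MonotoneOn (fun t => ρ t / q t) (Set.Ioi 0))
    (B : ℝ → ℝ → ℝ)
    (hB : ∀ s t, B s t = ρ (max s t) * q (min s t) - ρ (min s t) * q (max s t))
    (p : ℝ → ℝ → ℝ → ℝ)
    (hp : ∀ v x y, 0 < v →
      p v x y = (Real.sqrt (2 * Real.pi * v))⁻¹ * Real.exp (-(x - y)^2 / (2*v)))
    (A : ℝ → ℝ → ℝ) (hA : ∀ t s, A t s = R s s * R t t - R s t ^ 2)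
    (φ : ℝ → ℝ → ℝ → ℝ) (hφ : ∀ t r x, 0 < t → t < r → φ t r x = p (A t r / R r r) x 0)
    (ϕ : ℝ → ℝ → ℝ → ℝ)
    (hϕ : ∀ t r x, 0 < t → t < r →
      ϕ t r x = φ t r x / ∫ s in Set.Ioi t, φ t s x ∂(Measure.map τ P))
    (n : ℕ) (hn : 1 ≤ n) (t : ℕ → ℝ)
    (hmono : ∀ i j, 1 ≤ i → i < j → j ≤ n → t i < t j)
    (ht1 : 0 < t 1) (hFt1 : 0 < F (t 1))
    (u : ℝ) (htnu : t n < u)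
    (c : ℕ → ℝ → ℝ)
    (hc1 : ∀ r, c 1 r = ρ r / (ρ (t 1) * B (t 1) r))
    (hck : ∀ k, 2 ≤ k → ∀ r, c k r = B (t (k-1)) r / (B (t k) r * B (t (k-1)) (t k)))
    (ψ : ℕ → ℝ → ℝ → ℝ)
    (hψ : ∀ k, 1 ≤ k → k ≤ n - 1 → ∀ r x,
      ψ k r x = Real.sqrt (ρ r / B (t k) r) * Real.exp (-(1/2) * c k r * x^2) /
        ∫ s in Set.Ioc (t k) (t (k+1)),
          Real.sqrt (ρ s / B (t k) s) * Real.exp (-(1/2) * c k s * x^2) ∂(Measure.map τ P))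
    (𝔤 : ℝ → ℝ → ℝ) (h𝔤meas : Measurable (Function.uncurry 𝔤))
    (C : ℝ) (h𝔤bdd : ∀ r x, |𝔤 r x| ≤ C) :
    P[(fun ω => 𝔤 (τ ω) (ξ u ω))|⨆ k ∈ Finset.Icc 1 n,
        MeasurableSpace.comap (ξ (t k)) inferInstance] =ᵐ[P]
      fun ω => (∫ r in Set.Ioc (0:ℝ) (t 1), 𝔤 r 0 ∂(Measure.map τ P)) / F (t 1) *
          (if ξ (t 1) ω = 0 then 1 else 0)
        + ∑ k ∈ Finset.Icc 1 (n - 1),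
            (∫ r in Set.Ioc (t k) (t (k+1)),
                𝔤 r 0 * ψ k r (ξ (t k) ω) ∂(Measure.map τ P)) *
              (if ξ (t k) ω ≠ 0 ∧ ξ (t (k+1)) ω = 0 then 1 else 0)
        + (∫ r in Set.Ioc (t n) u, 𝔤 r 0 * ϕ (t n) r (ξ (t n) ω) ∂(Measure.map τ P)) *
            (if ξ (t n) ω ≠ 0 then 1 else 0)
        + (∫ r in Set.Ioi u,
              (∫ y, 𝔤 r y *
                p (B (t n) u * B u r / B (t n) r) y (B u r / B (t n) r * ξ (t n) ω)) *
                ϕ (t n) r (ξ (t n) ω) ∂(Measure.map τ P)) *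
            (if ξ (t n) ω ≠ 0 then 1 else 0) := by
  have hdet : ∀ s r, 0 < s → s < r → 0 < ρ r * q s - ρ s * q r := by
    intro s r hs hsr
    have hr := hs.trans hsr
    have h1 := hRnd s r hs hr hsr.ne
    rw [hfact s r hs.le hr.le, hfact s s hs.le hs.le, hfact r r hr.le hr.le, min_eq_left hsr.le,
      max_eq_right hsr.le, min_self, max_self, min_self, max_self] at h1
    have h2 : 0 < ρ s * q r * (ρ r * q s - ρ s * q r) := by nlinarith
    exact (pos_iff_pos_of_mul_pos h2).1 (mul_pos (hρpos s hs) (hqpos r hr))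
  obtain ⟨ρ', hρ'c, hρ'⟩ : ∃ ρ' : ℝ → ℝ, Continuous ρ' ∧ ∀ s, 0 < s → ρ' s = ρ s :=
    ⟨fun s => ρ (max s 0), hρcont.comp_continuous (by fun_prop) fun s => le_max_right s 0,
      fun s hs => by simp [hs.le]⟩
  obtain ⟨q', hq'c, hq'⟩ : ∃ q' : ℝ → ℝ, Continuous q' ∧ ∀ s, 0 < s → q' s = q s :=
    ⟨fun s => q (max s 0), hqcont.comp_continuous (by fun_prop) fun s => le_max_right s 0,
      fun s hs => by simp [hs.le]⟩
  obtain ⟨Z, hZ, hZle, hZX, h⟩ := IsGaussMarkov.exists_path hXmeas hXcont hGauss (ρ := ρ') (q := q')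
    (fun s r hs hsr => by
      have hr := hs.trans_le hsr
      rw [← hR, hfact s r hs.le hr.le, min_eq_left hsr, max_eq_right hsr, hρ' s hs, hq' r hr])
    hρ'c hq'c (fun s hs => by rw [hρ' s hs]; exact hρpos s hs)
    (fun s hs => by rw [hq' s hs]; exact hqpos s hs)
    (fun s r hs hsr => by
      have hr := hs.trans hsr
      rw [hρ' s hs, hρ' r hr, hq' s hs, hq' r hr]
      exact hdet s r hs hsr)
  have hind : IndepFun τ Z P := by
    rw [IndepFun_iff_Indep]
    exact indep_of_indep_of_le_right hindep hZle
  have hξb : ∀ s, 0 < s → ξ s = fun ω =>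
      IsGaussMarkov.bridge IsGaussMarkov.coordinate ρ' s (τ ω) (Z ω) := by
    intro s hs
    ext ω
    have hm : 0 < max (τ ω) s := hs.trans_le (le_max_right _ _)
    have hsm : s ≤ max (τ ω) s := le_max_right _ _
    rw [hξ, hξr, IsGaussMarkov.bridge, hZX s hs.le, hZX _ hm.le, hfact s _ hs.le hm.le,
      hfact _ _ hm.le hm.le,
      min_eq_left hsm, max_eq_right hsm, min_self, max_self, hρ' s hs, hρ' _ hm,
      mul_div_mul_right _ _ (hqpos _ hm).ne']
  have htpos : ∀ k, 1 ≤ k → k ≤ n → 0 < t k := by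
    intro k h1 hk
    rcases h1.eq_or_lt with rfl | h1
    · exact ht1
    · exact ht1.trans (hmono 1 k le_rfl h1 hk)
  have hu : 0 < u := (htpos n hn le_rfl).trans htnu
  have hFτ : F (t 1) = (P.map τ).real (Iic (t 1)) := by
    rw [hF, measureReal_def, Measure.map_apply hτmeas measurableSet_Iic]
    rfl
  have hBd : ∀ s r, 0 < s → s < r → B s r = ρ' r * q' s - ρ' s * q' r := by
    intro s r hs hsr
    have hr := hs.trans hsr
    rw [hB, max_eq_right hsr.le, min_eq_left hsr.le, hρ' s hs, hρ' r hr, hq' s hs, hq' r hr]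
  have hpg : ∀ v, 0 < v → ∀ x y, p v x y = gaussianPDFReal y v.toNNReal x := by
    intro v hv x y
    rw [hp v x y hv, gaussianPDFReal, Real.coe_toNNReal _ hv.le]
  have hφd : ∀ s r, 0 < s → s < r → ∀ x, φ s r x = IsGaussMarkov.density ρ' q' s r x := by
    intro s r hs hsr x
    have hr := hs.trans hsr
    have hv : A s r / R r r = IsGaussMarkov.bridgeVar ρ' q' s r := by
      have h1 := hρpos r hr
      have h2 := hqpos r hr
      rw [hA, hfact r s hr.le hs.le, hfact s s hs.le hs.le, hfact r r hr.le hr.le,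
        min_eq_right hsr.le, max_eq_left hsr.le, min_self, max_self, min_self, max_self,
        IsGaussMarkov.bridgeVar, hρ' s hs, hρ' r hr, hq' s hs, hq' r hr]
      field_simp
    rw [hφ s r x hs hsr, hv, hpg _ (h.bridgeVar_pos hs hsr), IsGaussMarkov.density]
  have hϕd : ∀ s r, 0 < s → s < r → ∀ x,
      ϕ s r x = IsGaussMarkov.density ρ' q' s r x /
        ∫ r in Ioi s, IsGaussMarkov.density ρ' q' s r x ∂(P.map τ) := by
    intro s r hs hsr x
    rw [hϕ s r x hs hsr, hφd s r hs hsr,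
      setIntegral_congr_fun measurableSet_Ioi fun r hr => hφd s r hs hr x]
  have hσ : ⨆ k ∈ Finset.Icc 1 n, MeasurableSpace.comap (ξ (t k)) inferInstance =
      ⨆ k ∈ Finset.Icc 1 n, MeasurableSpace.comap (fun ω =>
        IsGaussMarkov.bridge IsGaussMarkov.coordinate ρ' (t k) (τ ω) (Z ω))
        inferInstance :=
    iSup_congr fun k => iSup_congr fun hk => by
      rw [Finset.mem_Icc] at hk
      rw [hξb (t k) (htpos k hk.1 hk.2)]
  have hψd : ∀ k ∈ Finset.Icc 1 (n - 1), ∀ x,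
      ∫ r in Ioc (t k) (t (k + 1)), 𝔤 r 0 * ψ k r x ∂(P.map τ) =
        posteriorMean ((P.map τ).restrict (Ioc (t k) (t (k + 1))))
          (IsGaussMarkov.density ρ' q' (t k)) (fun r _ => 𝔤 r 0) x := by
    intro k hk x
    rw [Finset.mem_Icc] at hk
    have htk := htpos k hk.1 (by omega)
    simp only [hψ k hk.1 hk.2]
    obtain ⟨d, hd⟩ : ∃ d, ∀ r, t k < r → c k r = (IsGaussMarkov.bridgeVar ρ' q' (t k) r)⁻¹ + d := by
      rcases hk.1.eq_or_lt with rfl | hk1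
      · refine ⟨0, fun r hr => ?_⟩
        rw [hc1, IsGaussMarkov.bridgeVar, hBd _ _ htk hr, hρ' _ htk, hρ' r (htk.trans hr), inv_div,
          add_zero]
      · have hj := htpos (k - 1) (by omega) (by omega)
        have hjk : t (k - 1) < t k := hmono _ _ (by omega) (by omega) (by omega)
        refine ⟨ρ' (t (k - 1)) / (ρ' (t k) *
          (ρ' (t k) * q' (t (k - 1)) - ρ' (t (k - 1)) * q' (t k))), fun r hr => ?_⟩
        have h1 := (h.det_pos _ _ hj hjk).ne'
        have h2 := (h.det_pos _ _ htk hr).ne'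
        have h3 := (h.rho_pos _ htk).ne'
        rw [hck k hk1, hBd _ _ hj hjk, hBd _ _ htk hr, hBd _ _ hj (hjk.trans hr),
          IsGaussMarkov.bridgeVar,
          inv_div, div_add_div _ _ (mul_ne_zero h3 h2) (mul_ne_zero h3 h1),
          div_eq_div_iff (mul_ne_zero h2 h1) (mul_ne_zero (mul_ne_zero h3 h2) (mul_ne_zero h3 h1))]
        ring
    refine setIntegral_mul_div_setIntegral measurableSet_Ioc
      (a := √(2 * π * ρ' (t k)) * exp (-(1 / 2) * d * x ^ 2)) ?_ fun r hr => ?_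
    · have := h.rho_pos _ htk
      positivity
    · rw [hBd _ _ htk hr.1, ← hρ' r (htk.trans hr.1),
        h.sqrt_mul_exp_eq_mul_density htk hr.1 (hd r hr.1)]
  have hC : 0 ≤ C := (abs_nonneg _).trans (h𝔤bdd 0 0)
  have htn := htpos n hn le_rfl
  have hlast : ∀ x,
      ∫ r in Ioc (t n) u, 𝔤 r 0 * ϕ (t n) r x ∂(P.map τ) +
        ∫ r in Ioi u, (∫ y, 𝔤 r y * p (B (t n) u * B u r / B (t n) r) y
          (B u r / B (t n) r * x)) * ϕ (t n) r x ∂(P.map τ) =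
      posteriorMean ((P.map τ).restrict (Ioi (t n))) (IsGaussMarkov.density ρ' q' (t n))
        (IsGaussMarkov.futureMean ρ' q' 𝔤 (t n) u) x := by
    intro x
    rw [← IsGaussMarkov.setIntegral_add_setIntegral_eq_posteriorMean ρ' q' htnu
      (h.measurable_futureMean h𝔤meas (t n) u)
      (IsGaussMarkov.abs_futureMean_le hC h𝔤bdd ρ' q' (t n) u) x]
    congr 1
    · refine setIntegral_congr_fun measurableSet_Ioc fun r hr => ?_
      simp only [hϕd _ _ htn hr.1, IsGaussMarkov.futureMean, if_pos hr.2]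
    · refine setIntegral_congr_fun measurableSet_Ioi fun r hr => ?_
      have hr' : u < r := hr
      have hv := h.condVar_pos htn htnu hr'
      simp only [hϕd _ _ htn (htnu.trans hr'), IsGaussMarkov.futureMean, if_neg hr'.not_ge,
        hBd _ _ htn htnu, hBd _ _ hu hr', hBd _ _ htn (htnu.trans hr')]
      rw [IsGaussMarkov.condVar] at hv
      simp only [hpg _ hv, IsGaussMarkov.condVar, IsGaussMarkov.slope]
  rw [hσ, hξb u hu]
  refine (h.condExp_bridge hZ hτmeas hτpos hind hn hmono ht1 (hFτ ▸ hFt1.ne') htnu h𝔤meas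
    h𝔤bdd).trans (.of_forall fun ω => ?_)
  have hx : ∀ k, 1 ≤ k → k ≤ n → IsGaussMarkov.bridge IsGaussMarkov.coordinate ρ'
      (t k) (τ ω) (Z ω) = ξ (t k) ω := fun k h1 hk => (congrFun (hξb _ (htpos k h1 hk)) ω).symm
  simp only [IsGaussMarkov.predictor]
  rw [add_assoc (_ + _), ← add_mul, hlast, hFτ]
  simp only [hx 1 le_rfl hn, hx n hn le_rfl]
  congr 2
  refine Finset.sum_congr rfl fun k hk => ?_
  have hk' := Finset.mem_Icc.1 hk
  simp only [hψd k hk, hx k hk'.1 (by omega), hx (k + 1) (by omega) (by omega)]
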